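/- arXiv:1503.03895 — 2 statements merged into one kernel-verified Lean document; each statement's English description precedes it below -/
import Mathlib

section
/- Let μ be a Borel probability measure on ℝ with μ([0,∞)) = 1, let F(t) = μ([0,t]). Let κ ∈ (0,1) and let L be a slowly varying function, and assume that 1 − F(t) ~ L(t)/t^κ as t → ∞. Then there exist C > 0 and t₁ > 0 such that for all t ∈ (0, t₁): ∫₀^∞ |e^{itx} − 1| μ(dx) ≤ C t^κ L(1/t). -/
open MeasureTheory Filter

/-- A function bounded by `1` that contracts by `1 / 2` under doubling, up to an error `V` which
itself contracts at a slower rate `r > 1 / 2`, is bounded by a multiple of `V`. -/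
theorem exists_le_mul_of_doubling {P V : ℝ → ℝ} {T₀ r b : ℝ} (hT₀ : 0 < T₀) (hr : 1 / 2 < r)
    (hb : 0 < b) (hV₀ : ∀ T ≥ T₀, 0 < V T) (hVb : ∀ T ∈ Set.Icc T₀ (2 * T₀), b ≤ V T)
    (hP₁ : ∀ T ≥ T₀, P T ≤ 1) (hP : ∀ T ≥ T₀, P (2 * T) ≤ P T / 2 + V T)
    (hV : ∀ T ≥ T₀, r * V T ≤ V (2 * T)) :
    ∃ C > 0, ∀ T ≥ T₀, P T ≤ C * V T := by
  have hr' : 0 < r - 1 / 2 := by linarith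
  obtain ⟨C, hCb, hCr⟩ : ∃ C : ℝ, 1 / b ≤ C ∧ 1 / (r - 1 / 2) ≤ C :=
    ⟨_, le_max_left _ _, le_max_right _ _⟩
  have hC : 0 < C := lt_of_lt_of_le (by positivity) hCb
  rw [div_le_iff₀ hb] at hCb
  rw [div_le_iff₀ hr'] at hCr
  refine ⟨C, hC, ?_⟩
  have key : ∀ n : ℕ, ∀ T ≥ T₀, T ≤ 2 ^ n * (2 * T₀) → P T ≤ C * V T := by
    intro n
    induction n with
    | zero =>
      intro T hT hT'
      have h := hVb T ⟨hT, by simpa using hT'⟩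
      nlinarith [hP₁ T hT]
    | succ n ih =>
      intro T hT hT'
      rcases le_total T (2 * T₀) with h | h
      · nlinarith [hP₁ T hT, hVb T ⟨hT, h⟩]
      · have hS : T / 2 ≥ T₀ := by linarith
        have h₁ := ih (T / 2) hS (by rw [pow_succ] at hT'; linarith)
        have h₂ := hP _ hS
        have h₃ := hV _ hS
        have h₄ := hV₀ _ hS
        rw [show 2 * (T / 2) = T by ring] at h₂ h₃
        nlinarith [mul_le_mul_of_nonneg_left h₃ hC.le, mul_le_mul_of_nonneg_right hCr h₄.le]
  intro T hT
  obtain ⟨n, hn⟩ := pow_unbounded_of_one_lt (T / (2 * T₀)) (one_lt_two : (1 : ℝ) < 2)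
  rw [div_lt_iff₀ (by positivity)] at hn
  exact key n T hT hn.le

theorem integrable_min_one_abs_div (μ : Measure ℝ) [IsFiniteMeasure μ] {T : ℝ} (hT : 0 < T) :
    Integrable (fun x => min 1 (|x| / T)) μ := by
  refine Integrable.of_bound (by fun_prop) 1 (ae_of_all _ fun x => ?_)
  rw [Real.norm_of_nonneg (by positivity)]
  exact min_le_left _ _

theorem integral_min_one_abs_div_le_one (μ : Measure ℝ) [IsProbabilityMeasure μ] {T : ℝ}
    (hT : 0 < T) : ∫ x, min 1 (|x| / T) ∂μ ≤ 1 := by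
  simpa using integral_mono (integrable_min_one_abs_div μ hT) (integrable_const (1 : ℝ))
    fun x => min_le_left _ _

theorem integral_min_one_abs_div_two_mul_le (μ : Measure ℝ) [IsProbabilityMeasure μ]
    (hμ : ∀ᵐ x ∂μ, 0 ≤ x) {T : ℝ} (hT : 0 < T) :
    ∫ x, min 1 (|x| / (2 * T)) ∂μ
      ≤ (∫ x, min 1 (|x| / T) ∂μ) / 2 + (1 - μ.real (Set.Icc 0 T)) / 2 := by
  have hind : Integrable ((Set.Icc 0 T)ᶜ.indicator (1 : ℝ → ℝ)) μ :=
    (integrable_const (1 : ℝ)).indicator measurableSet_Icc.compl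
  have hmin := integrable_min_one_abs_div μ hT
  calc ∫ x, min 1 (|x| / (2 * T)) ∂μ
      ≤ ∫ x, (min 1 (|x| / T) / 2 + (Set.Icc 0 T)ᶜ.indicator 1 x / 2) ∂μ := by
        refine integral_mono_ae (integrable_min_one_abs_div μ (by positivity))
          ((hmin.div_const 2).add (hind.div_const 2)) (hμ.mono fun x hx => ?_)
        have hdiv : |x| / (2 * T) = |x| / T / 2 := by ring
        by_cases h : x ≤ T
        · have h₁ : |x| / T ≤ 1 := by rw [div_le_one hT, abs_of_nonneg hx]; exact h
          simp [hx, h, hdiv, min_eq_right h₁]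
        · have h₁ : 1 ≤ |x| / T := by
            rw [one_le_div hT, abs_of_nonneg hx]; exact (not_le.1 h).le
          simp only [min_eq_left h₁]
          rw [Set.indicator_of_mem (by simp [h])]
          norm_num
    _ = _ := by
        rw [integral_add (hmin.div_const 2) (hind.div_const 2), integral_div, integral_div,
          integral_indicator_one measurableSet_Icc.compl, probReal_compl_eq_one_sub
          measurableSet_Icc]

theorem norm_exp_mul_I_sub_one_le_two_mul_min (y : ℝ) :
    ‖Complex.exp ((y : ℂ) * Complex.I) - 1‖ ≤ 2 * min 1 |y| := by
  rw [mul_min_of_nonneg _ _ zero_le_two, le_min_iff]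
  constructor
  · refine (norm_sub_le _ _).trans ?_
    rw [Complex.norm_exp_ofReal_mul_I, norm_one]
    norm_num
  · have h := Real.norm_exp_I_mul_ofReal_sub_one_le (x := y)
    rw [mul_comm, Real.norm_eq_abs] at h
    linarith [abs_nonneg y]

theorem integral_norm_exp_mul_I_sub_one_le (μ : Measure ℝ) [IsFiniteMeasure μ] {t : ℝ}
    (ht : 0 < t) :
    ∫ x, ‖Complex.exp (((t * x : ℝ) : ℂ) * Complex.I) - 1‖ ∂μ
      ≤ 2 * ∫ x, min 1 (|x| / (1 / t)) ∂μ := by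
  rw [← integral_const_mul]
  refine integral_mono_of_nonneg (ae_of_all _ fun _ => norm_nonneg _)
    ((integrable_min_one_abs_div μ (by positivity)).const_mul 2) (ae_of_all _ fun x => ?_)
  have h := norm_exp_mul_I_sub_one_le_two_mul_min (t * x)
  rwa [abs_mul, abs_of_pos ht, show t * |x| = |x| / (1 / t) by field_simp] at h

/-- Bound `∫ |e^{itx}-1| dμ(x) ≤ C t^κ L(1/t)` for small `t > 0`
under the heavy-tail hypothesis. -/
theorem stmt_6 (μ : Measure ℝ) [IsProbabilityMeasure μ] (hμ : μ (Set.Ici 0) = 1)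
    (F : ℝ → ℝ) (hF : ∀ t, F t = (μ (Set.Icc 0 t)).toReal)
    (κ : ℝ) (hκ : κ ∈ Set.Ioo (0:ℝ) 1)
    (L : ℝ → ℝ) (hLpos : ∀ t > 0, 0 < L t) (hLmeas : Measurable L)
    (hLslow : ∀ lam > 0, Tendsto (fun t => L (lam * t) / L t) atTop (nhds 1))
    (htail : Tendsto (fun t => (1 - F t) / (L t / t ^ κ)) atTop (nhds 1)) :
    ∃ C > (0:ℝ), ∃ t₁ > (0:ℝ), ∀ t ∈ Set.Ioo (0:ℝ) t₁,
      (∫ x, ‖Complex.exp (((t * x : ℝ) : ℂ) * Complex.I) - 1‖ ∂μ)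
        ≤ C * t ^ κ * L (1 / t) := by
  have hμ' : ∀ᵐ x ∂μ, 0 ≤ x := (prob_compl_eq_zero_iff measurableSet_Ici).2 hμ
  have hF' : ∀ t, F t = μ.real (Set.Icc 0 t) := hF
  have hFmono : Monotone F := fun s t hst => by
    rw [hF', hF']
    exact measureReal_mono (Set.Icc_subset_Icc_right hst)
  have hVpos : ∀ T > 0, 0 < L T / T ^ κ := fun T hT =>
    div_pos (hLpos T hT) (Real.rpow_pos_of_pos hT κ)
  have htwo : (1 / 2 : ℝ) < 2 ^ (-κ) := by
    have := Real.rpow_lt_rpow_of_exponent_lt (one_lt_two : (1 : ℝ) < 2) (neg_lt_neg hκ.2)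
    rwa [Real.rpow_neg_one, ← one_div] at this
  obtain ⟨r, hr, hr'⟩ := exists_between htwo
  have hslow : ∀ᶠ T in atTop, r * 2 ^ κ < L (2 * T) / L T := by
    refine (hLslow 2 two_pos).eventually (lt_mem_nhds ?_)
    rwa [Real.rpow_neg zero_le_two, ← one_div, lt_div_iff₀ (by positivity)] at hr'
  have hevent := (((htail.eventually (gt_mem_nhds one_lt_two)).and
    (htail.eventually (lt_mem_nhds one_pos))).and hslow).and (eventually_gt_atTop 0)
  obtain ⟨T₀, hT₀⟩ := eventually_atTop.1 hevent
  have hT₀pos : 0 < T₀ := (hT₀ T₀ le_rfl).2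
  have htail_le : ∀ T ≥ T₀, 1 - F T ≤ 2 * (L T / T ^ κ) := fun T hT =>
    ((div_lt_iff₀ (hVpos T (hT₀ T hT).2)).1 (hT₀ T hT).1.1.1).le
  have htail_pos : 0 < 1 - F (2 * T₀) := by
    have h := hT₀ (2 * T₀) (by linarith)
    exact (div_pos_iff_of_pos_right (hVpos _ h.2)).1 h.1.1.2
  obtain ⟨C, hC, hbound⟩ := exists_le_mul_of_doubling
    (P := fun T => ∫ x, min 1 (|x| / T) ∂μ) (V := fun T => L T / T ^ κ)
    (b := (1 - F (2 * T₀)) / 2) hT₀pos hr (by positivity)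
    (fun T hT => hVpos T (hT₀ T hT).2)
    (fun T hT => by linarith [htail_le T hT.1, hFmono hT.2])
    (fun T hT => integral_min_one_abs_div_le_one μ (hT₀ T hT).2)
    (fun T hT => by
      have h := integral_min_one_abs_div_two_mul_le μ hμ' (hT₀ T hT).2
      rw [← hF'] at h
      linarith [htail_le T hT])
    (fun T hT => by
      have hT' := (hT₀ T hT).2
      have h := (lt_div_iff₀ (hLpos T hT')).1 (hT₀ T hT).1.2
      have hpow := Real.rpow_pos_of_pos hT' κ
      rw [Real.mul_rpow zero_le_two hT'.le, le_div_iff₀ (by positivity)]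
      calc r * (L T / T ^ κ) * (2 ^ κ * T ^ κ) = r * 2 ^ κ * L T := by field_simp
        _ ≤ L (2 * T) := h.le)
  refine ⟨2 * C, by positivity, 1 / T₀, by positivity, fun t ht => ?_⟩
  have hT : T₀ ≤ 1 / t := ((lt_one_div ht.1 hT₀pos).1 ht.2).le
  calc _ ≤ 2 * ∫ x, min 1 (|x| / (1 / t)) ∂μ := integral_norm_exp_mul_I_sub_one_le μ ht.1
    _ ≤ 2 * (C * (L (1 / t) / (1 / t) ^ κ)) := by gcongr; exact hbound _ hT
    _ = 2 * C * t ^ κ * L (1 / t) := by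
        rw [one_div t, Real.inv_rpow ht.1.le, div_inv_eq_mul]
        ring
end

section
/- Let (d_n)_{n∈ℕ} be a family of nonnegative reals, δ > 0, κ ∈ (0,1), and let L be a slowly varying function. Assume that Σ_n e^{−δ d_n} < ∞ and that Σ_{n : d_n > t} e^{−δ d_n} = o(L(t)/t^κ) as t → ∞. Then Σ_n |e^{i t d_n} − 1| · e^{−δ d_n} = o(t^κ L(1/t)) as t → 0⁺. -/
open Filter
open scoped ENNReal

/-- A nonnegative function that contracts up to a vanishing error under doubling of its argument,
and that is bounded on dyadic blocks, tends to zero. -/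
theorem tendsto_zero_of_doubling_contraction {H : ℝ → ℝ} {q : ℝ} (hq0 : 0 ≤ q) (hq1 : q < 1)
    (hH : ∀ t > 0, 0 ≤ H t)
    (hrec : ∀ η > 0, ∀ᶠ t in atTop, H (2 * t) ≤ q * H t + η)
    (hbdd : ∀ᶠ A : ℝ in atTop, ∃ M, ∀ s ∈ Set.Icc A (2 * A), H s ≤ M) :
    Tendsto H atTop (nhds 0) := by
  rw [Metric.tendsto_atTop]
  intro ε hε
  have h1q : 0 < 1 - q := by linarith
  obtain ⟨A₀, hA₀⟩ := eventually_atTop.1 (hrec (ε / 2 * (1 - q)) (by positivity))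
  obtain ⟨A₁, hA₁⟩ := eventually_atTop.1 hbdd
  set A := max (max A₀ A₁) 1
  have hA1 : 1 ≤ A := le_max_right _ _
  have hApos : 0 < A := by linarith
  have hAA₀ : A₀ ≤ A := (le_max_left _ _).trans (le_max_left _ _)
  obtain ⟨M, hM⟩ := hA₁ A ((le_max_right _ _).trans (le_max_left _ _))
  have hM0 : 0 ≤ M := (hH A hApos).trans (hM A ⟨le_rfl, by linarith⟩)
  have iter : ∀ k : ℕ, ∀ s ∈ Set.Icc A (2 * A), H (2 ^ k * s) ≤ q ^ k * M + ε / 2 := by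
    intro k s hs
    induction k with
    | zero => simpa using (hM s hs).trans (by linarith)
    | succ k ih =>
      have hk : (1 : ℝ) ≤ 2 ^ k := one_le_pow₀ (by norm_num)
      have hle : A₀ ≤ 2 ^ k * s := by nlinarith [hs.1]
      calc H (2 ^ (k + 1) * s) = H (2 * (2 ^ k * s)) := by ring_nf
        _ ≤ q * H (2 ^ k * s) + ε / 2 * (1 - q) := hA₀ _ hle
        _ ≤ q * (q ^ k * M + ε / 2) + ε / 2 * (1 - q) := by gcongr
        _ = q ^ (k + 1) * M + ε / 2 := by ring
  have hlim : Tendsto (fun k : ℕ => q ^ k * M) atTop (nhds 0) := by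
    simpa using (tendsto_pow_atTop_nhds_zero_of_lt_one hq0 hq1).mul_const M
  obtain ⟨N, hN⟩ := (hlim.eventually_lt_const (half_pos hε)).exists
  refine ⟨2 ^ N * A, fun T hT => ?_⟩
  have hN1 : (1 : ℝ) ≤ 2 ^ N := one_le_pow₀ (by norm_num)
  have hTA : 2 ^ N ≤ T / A := (le_div_iff₀ hApos).2 hT
  obtain ⟨k, hk1, hk2⟩ := exists_nat_pow_near (hN1.trans hTA) (by norm_num : (1 : ℝ) < 2)
  have hNk : N ≤ k := by
    have : (2 : ℝ) ^ N < 2 ^ (k + 1) := hTA.trans_lt hk2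
    have := (pow_lt_pow_iff_right₀ (by norm_num : (1 : ℝ) < 2)).1 this
    omega
  have h2k : (0 : ℝ) < 2 ^ k := by positivity
  have hs : T / 2 ^ k ∈ Set.Icc A (2 * A) := by
    constructor
    · rw [le_div_iff₀ h2k]
      rw [le_div_iff₀ hApos] at hk1
      linarith
    · rw [div_le_iff₀ h2k]
      rw [div_lt_iff₀ hApos, pow_succ] at hk2
      linarith
  have hfin := iter k _ hs
  rw [mul_div_cancel₀ _ h2k.ne'] at hfin
  have hqk : q ^ k * M ≤ q ^ N * M :=
    mul_le_mul_of_nonneg_right (pow_le_pow_of_le_one hq0 hq1.le hNk) hM0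
  have hTpos : 0 < T := by nlinarith
  rw [Real.dist_eq, sub_zero, abs_of_nonneg (hH T hTpos)]
  linarith

/-- Abelian estimate for truncated first moments: if the tails `∑_{d n > t} w n` of a positive
summable weight are `o(L t / t ^ κ)` with `L` slowly varying along doubling, then so are the
truncated means `∑ min 2 (d n / t) * w n`. -/
theorem tendsto_truncated_mean_of_tail {d w : ℕ → ℝ} (hd : ∀ n, 0 ≤ d n) (hw : ∀ n, 0 < w n)
    (hsum : Summable w) (hunb : ∀ t, ∃ n, t < d n) {κ : ℝ} (hκ : κ < 1)
    {L : ℝ → ℝ} (hLpos : ∀ t > 0, 0 < L t)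
    (hLslow : Tendsto (fun t => L (2 * t) / L t) atTop (nhds 1))
    (htail : Tendsto (fun t : ℝ => (∑' n, if t < d n then w n else 0) / (L t / t ^ κ))
      atTop (nhds 0)) :
    Tendsto (fun t : ℝ => (∑' n, min 2 (d n / t) * w n) / (L t / t ^ κ)) atTop (nhds 0) := by
  set F : ℝ → ℝ := fun t => ∑' n, if t < d n then w n else 0
  set G : ℝ → ℝ := fun t => ∑' n, min 2 (d n / t) * w n
  have hFterm : ∀ t n, 0 ≤ if t < d n then w n else 0 := fun t n => by
    split_ifs
    exacts [(hw n).le, le_rfl]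
  have hFsum : ∀ t, Summable fun n => if t < d n then w n else 0 := fun t =>
    hsum.of_nonneg_of_le (hFterm t) fun n => by
      split_ifs
      exacts [le_rfl, (hw n).le]
  have hFpos : ∀ t, 0 < F t := fun t => by
    obtain ⟨n, hn⟩ := hunb t
    exact (hFsum t).tsum_pos (hFterm t) n (by simpa [hn] using hw n)
  have hFanti : Antitone F := fun s t hst =>
    (hFsum t).tsum_le_tsum (fun n => by
      split_ifs with h1 h2
      exacts [le_rfl, absurd (hst.trans_lt h1) h2, (hw n).le, le_rfl]) (hFsum s)
  have hGterm : ∀ t > 0, ∀ n, 0 ≤ min 2 (d n / t) * w n := fun t ht n =>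
    mul_nonneg (le_min (by norm_num) (div_nonneg (hd n) ht.le)) (hw n).le
  have hGle : ∀ t n, min 2 (d n / t) * w n ≤ 2 * w n := fun t n =>
    mul_le_mul_of_nonneg_right (min_le_left _ _) (hw n).le
  have hGsum : ∀ t > 0, Summable fun n => min 2 (d n / t) * w n := fun t ht =>
    (hsum.mul_left 2).of_nonneg_of_le (hGterm t ht) (hGle t)
  have hG0 : ∀ t > 0, 0 ≤ G t := fun t ht => tsum_nonneg (hGterm t ht)
  have hGbdd : ∀ t > 0, G t ≤ 2 * ∑' n, w n := fun t ht => by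
    rw [← tsum_mul_left]
    exact (hGsum t ht).tsum_le_tsum (hGle t) (hsum.mul_left 2)
  have hGrec : ∀ t > 0, G (2 * t) ≤ 1 / 2 * G t + 2 * F t := fun t ht => by
    rw [← tsum_mul_left, ← tsum_mul_left,
      ← ((hGsum t ht).mul_left _).tsum_add ((hFsum t).mul_left _)]
    refine (hGsum _ (by positivity)).tsum_le_tsum (fun n => ?_)
      (((hGsum t ht).mul_left _).add ((hFsum t).mul_left _))
    split_ifs with h
    · linarith [hGle (2 * t) n, hGterm t ht n]
    · have h1 : d n / t ≤ 1 := (div_le_one ht).2 (not_lt.1 h)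
      have h2 : min 2 (d n / (2 * t)) ≤ 1 / 2 * min 2 (d n / t) := by
        rw [min_eq_right (by linarith : d n / t ≤ 2)]
        exact (min_le_right _ _).trans_eq (by field_simp)
      nlinarith [hw n]
  have hden : ∀ t > 0, 0 < L t / t ^ κ := fun t ht =>
    div_pos (hLpos t ht) (Real.rpow_pos_of_pos ht κ)
  have hratio : Tendsto (fun t => (L t / t ^ κ) / (L (2 * t) / (2 * t) ^ κ)) atTop
      (nhds (2 ^ κ)) := by
    have := (hLslow.inv₀ one_ne_zero).const_mul ((2 : ℝ) ^ κ)
    rw [inv_one, mul_one] at this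
    refine this.congr' ?_
    filter_upwards [eventually_gt_atTop 0] with t ht
    have h1 := (hLpos t ht).ne'
    have h2 := (hLpos (2 * t) (by positivity)).ne'
    have h3 := (Real.rpow_pos_of_pos ht κ).ne'
    have h4 := (Real.rpow_pos_of_pos two_pos κ).ne'
    rw [Real.mul_rpow zero_le_two ht.le]
    field_simp
  have h2κ : (2 : ℝ) ^ κ < 2 := by
    simpa using Real.rpow_lt_rpow_of_exponent_lt one_lt_two hκ
  obtain ⟨r, hr1, hr2⟩ := exists_between h2κ
  have hr0 : 0 < r := (Real.rpow_pos_of_pos two_pos κ).trans hr1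
  refine tendsto_zero_of_doubling_contraction (q := r / 2) (by positivity) (by linarith)
    (fun t ht => div_nonneg (hG0 t ht) (hden t ht).le) (fun η hη => ?_) ?_
  · filter_upwards [eventually_gt_atTop 0, hratio.eventually_lt_const hr1,
      htail.eventually_lt_const (show 0 < η / (2 * r) by positivity)] with t ht hρ hF
    have hD := hden t ht
    have hD2 := hden (2 * t) (by positivity)
    have hF' : F t / (L t / t ^ κ) < η / (2 * r) := hF
    have hFD : 0 ≤ F t / (L t / t ^ κ) := div_nonneg (hFpos t).le hD.le
    have hGD : 0 ≤ G t / (L t / t ^ κ) := div_nonneg (hG0 t ht) hD.le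
    calc G (2 * t) / (L (2 * t) / (2 * t) ^ κ)
        ≤ (1 / 2 * G t + 2 * F t) / (L (2 * t) / (2 * t) ^ κ) := by
          gcongr
          exact hGrec t ht
      _ = ((L t / t ^ κ) / (L (2 * t) / (2 * t) ^ κ)) *
            (1 / 2 * (G t / (L t / t ^ κ)) + 2 * (F t / (L t / t ^ κ))) := by
          generalize L t / t ^ κ = D at *
          generalize L (2 * t) / (2 * t) ^ κ = D' at *
          field_simp
      _ ≤ r * (1 / 2 * (G t / (L t / t ^ κ)) + 2 * (η / (2 * r))) := by
          gcongr
      _ = r / 2 * (G t / (L t / t ^ κ)) + η := by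
          field_simp
  · obtain ⟨A₀, hA₀⟩ := eventually_atTop.1 (htail.eventually_lt_const one_pos)
    filter_upwards [eventually_ge_atTop A₀, eventually_gt_atTop 0] with A hA hApos
    refine ⟨(2 * ∑' n, w n) / F (2 * A), fun s hs => ?_⟩
    have hspos : 0 < s := hApos.trans_le hs.1
    have hFs : F s / (L s / s ^ κ) < 1 := hA₀ s (hA.trans hs.1)
    rw [div_lt_one (hden s hspos)] at hFs
    exact div_le_div₀ (mul_nonneg zero_le_two (tsum_nonneg fun n => (hw n).le))
      (hGbdd s hspos) (hFpos _) ((hFanti hs.2).trans hFs.le)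

/-- Estimate (6.6) of the paper: if `Σ_n e^{-δ d_n} < ∞` and the tail
is `o(L(t)/t^κ)`, then `Σ_n |e^{itd_n}-1| e^{-δ d_n} = o(t^κ L(1/t))` as `t → 0⁺`. -/
theorem stmt_9 (d : ℕ → ℝ) (hd : ∀ n, 0 ≤ d n) (δ : ℝ) (hδ : 0 < δ)
    (κ : ℝ) (hκ : κ ∈ Set.Ioo (0:ℝ) 1)
    (L : ℝ → ℝ) (hLpos : ∀ t > 0, 0 < L t) (hLmeas : Measurable L)
    (hLslow : ∀ lam > 0, Tendsto (fun t => L (lam * t) / L t) atTop (nhds 1))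
    (hsum : Summable fun n => Real.exp (-δ * d n))
    (htail : Tendsto (fun t : ℝ =>
        (∑' n : ℕ, if t < d n then ENNReal.ofReal (Real.exp (-δ * d n)) else 0).toReal
          / (L t / t ^ κ)) atTop (nhds 0)) :
    Tendsto (fun t : ℝ =>
        (∑' n : ℕ, ‖Complex.exp (((t * d n : ℝ) : ℂ) * Complex.I) - 1‖
            * Real.exp (-δ * d n)) / (t ^ κ * L (1 / t)))
      (nhdsWithin 0 (Set.Ioi 0)) (nhds 0) := by
  have hunb : ∀ t, ∃ n, t < d n := fun t => by
    obtain ⟨n, hn⟩ :=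
      (hsum.tendsto_atTop_zero.eventually_lt_const (Real.exp_pos (-δ * t))).exists
    exact ⟨n, by nlinarith [Real.exp_lt_exp.1 hn]⟩
  have htail' : Tendsto (fun t : ℝ =>
      (∑' n, if t < d n then Real.exp (-δ * d n) else 0) / (L t / t ^ κ)) atTop (nhds 0) := by
    refine htail.congr fun t => ?_
    rw [ENNReal.tsum_toReal_eq fun n => by split_ifs <;> simp]
    congr 2 with n
    split_ifs
    · exact ENNReal.toReal_ofReal (Real.exp_pos _).le
    · rfl
  have hmean := (tendsto_truncated_mean_of_tail hd (fun n => Real.exp_pos _) hsum hunb hκ.2 hLpos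
    (hLslow 2 two_pos) htail').comp tendsto_inv_nhdsGT_zero
  have hnorm : ∀ t > 0, ∀ n, ‖Complex.exp (((t * d n : ℝ) : ℂ) * Complex.I) - 1‖
      ≤ min 2 (d n / t⁻¹) := fun t ht n => by
    refine le_min ?_ ?_
    · refine (norm_sub_le _ _).trans ?_
      rw [Complex.norm_exp_ofReal_mul_I, norm_one]
      norm_num
    · rw [div_inv_eq_mul, mul_comm (d n)]
      have := Real.norm_exp_I_mul_ofReal_sub_one_le (x := t * d n)
      rwa [mul_comm Complex.I, Real.norm_of_nonneg (mul_nonneg ht.le (hd n))] at this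
  refine squeeze_zero' ?_ ?_ hmean
  · filter_upwards [self_mem_nhdsWithin] with t ht
    have ht : 0 < t := ht
    exact div_nonneg (tsum_nonneg fun n => by positivity)
      (mul_nonneg (Real.rpow_nonneg ht.le κ) (hLpos _ (by positivity)).le)
  · filter_upwards [self_mem_nhdsWithin] with t ht
    have ht : 0 < t := ht
    have hL := hLpos t⁻¹ (by positivity)
    have htκ := Real.rpow_pos_of_pos ht κ
    have hden : L t⁻¹ / t⁻¹ ^ κ = t ^ κ * L (1 / t) := by
      rw [Real.inv_rpow ht.le, div_inv_eq_mul, one_div, mul_comm]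
    have hle : ∀ n, ‖Complex.exp (((t * d n : ℝ) : ℂ) * Complex.I) - 1‖ * Real.exp (-δ * d n)
        ≤ min 2 (d n / t⁻¹) * Real.exp (-δ * d n) := fun n =>
      mul_le_mul_of_nonneg_right (hnorm t ht n) (Real.exp_pos _).le
    have hS : Summable fun n => min 2 (d n / t⁻¹) * Real.exp (-δ * d n) :=
      (hsum.mul_left 2).of_nonneg_of_le
        (fun n => (mul_nonneg (norm_nonneg _) (Real.exp_pos _).le).trans (hle n))
        fun n => mul_le_mul_of_nonneg_right (min_le_left _ _) (Real.exp_pos _).le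
    simp only [Function.comp_apply, hden]
    refine div_le_div_of_nonneg_right ?_ (by rw [one_div]; positivity)
    exact (hS.of_nonneg_of_le (fun n => by positivity) hle).tsum_le_tsum hle hS
end
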